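/- For all n ≥ 1 and k ∈ ℕ, the set of unitary 2^n × 2^n complex matrices U such that √2^k·U has all entries in ℤ[ω] (i.e., with denominator exponent k) has cardinality at least 2^(2^(n−1)·k). -/

import Mathlib

noncomputable section

/-- The eighth root of unity `ω = e^{iπ/4} = (1+i)/√2`. -/
def ω : ℂ := (1 + Complex.I) / Real.sqrt 2

/-- A rational number is dyadic if it has the form `a / 2^n` with `a ∈ ℤ`, `n ∈ ℕ`. -/
def IsDyadic (q : ℚ) : Prop := ∃ (a : ℤ) (n : ℕ), q = a / 2 ^ n

/-- Membership in the ring `𝔻[ω] = ℤ[1/√2, i]`: complex numbers of the form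
`aω³ + bω² + cω + d` with `a, b, c, d` dyadic rationals. -/
def inDω (t : ℂ) : Prop :=
  ∃ a b c d : ℚ, IsDyadic a ∧ IsDyadic b ∧ IsDyadic c ∧ IsDyadic d ∧
    t = (a : ℂ) * ω ^ 3 + (b : ℂ) * ω ^ 2 + (c : ℂ) * ω + (d : ℂ)

/-- Membership in the ring `ℤ[ω]`: complex numbers of the form
`aω³ + bω² + cω + d` with `a, b, c, d ∈ ℤ`. -/
def inZω (t : ℂ) : Prop :=
  ∃ a b c d : ℤ, t = (a : ℂ) * ω ^ 3 + (b : ℂ) * ω ^ 2 + (c : ℂ) * ω + (d : ℂ)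

lemma sqrt2_sq' : ((Real.sqrt 2 : ℝ) : ℂ) ^ 2 = 2 := by
  norm_cast
  rw [Real.sq_sqrt (by norm_num)]

lemma sqrt2_ne' : ((Real.sqrt 2 : ℝ) : ℂ) ≠ 0 := by
  intro h
  have := sqrt2_sq'
  rw [h] at this
  norm_num at this

lemma omega_sq : ω ^ 2 = Complex.I := by
  unfold ω
  rw [div_pow, sqrt2_sq']
  have := Complex.I_sq
  linear_combination (1/2) * this

lemma omega_four : ω ^ 4 = -1 := by
  have h := omega_sq
  have := Complex.I_sq
  linear_combination (ω ^ 2 + Complex.I) * h + this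

lemma conj_omega : (starRingEnd ℂ) ω = - ω ^ 3 := by
  have h : ω ^ 3 = ω * Complex.I := by rw [← omega_sq]; ring
  rw [h]
  unfold ω
  simp only [map_div₀, map_add, map_one, Complex.conj_I, Complex.conj_ofReal]
  have := Complex.I_sq
  have h0 := sqrt2_ne'
  field_simp
  linear_combination this

lemma sqrt2_omega : ((Real.sqrt 2 : ℝ) : ℂ) = ω - ω ^ 3 := by
  have h : ω ^ 3 = ω * Complex.I := by rw [← omega_sq]; ring
  rw [h]
  unfold ω
  have := Complex.I_sq
  have h2 := sqrt2_sq'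
  have h0 := sqrt2_ne'
  field_simp
  linear_combination this + h2

lemma inZ_add {s t : ℂ} (hs : inZω s) (ht : inZω t) : inZω (s + t) := by
  obtain ⟨a, b, c, d, rfl⟩ := hs
  obtain ⟨a', b', c', d', rfl⟩ := ht
  exact ⟨a + a', b + b', c + c', d + d', by push_cast; ring⟩

lemma inZ_mul {s t : ℂ} (hs : inZω s) (ht : inZω t) : inZω (s * t) := by
  obtain ⟨a, b, c, d, rfl⟩ := hs
  obtain ⟨p, q, r, s, rfl⟩ := ht
  refine ⟨a * s + b * r + c * q + d * p, b * s + c * r + d * q - a * p,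
    c * s + d * r - a * q - b * p, d * s - a * r - b * q - c * p, ?_⟩
  have h := omega_four
  push_cast
  linear_combination (a * p * ω ^ 2 + (a * q + b * p) * ω + (a * r + b * q + c * p)) * h

lemma inZ_zero : inZω 0 := ⟨0, 0, 0, 0, by simp⟩
lemma inZ_one : inZω 1 := ⟨0, 0, 0, 1, by simp⟩

/-- The scaled letters: `√2·HT` and `√2·SHT`. -/
def ltr : Bool → Matrix (Fin 2) (Fin 2) ℂ
  | false => !![1, ω; 1, -ω]
  | true => !![1, ω; ω ^ 2, -ω ^ 3]

/-- Product of the scaled letters of a word. -/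
def wrd : List Bool → Matrix (Fin 2) (Fin 2) ℂ
  | [] => 1
  | b :: l => ltr b * wrd l

/-- Embedding of `ℤ[√2]` in `ℂ`. -/
def emb (x : ℤ√2) : ℂ := (x.re : ℂ) + x.im * (Real.sqrt 2 : ℝ)

/-- The traceless Hermitian matrix with given Bloch coordinates. -/
def blo (x y z : ℤ√2) : Matrix (Fin 2) (Fin 2) ℂ :=
  !![emb z, emb x - ω ^ 2 * emb y; emb x + ω ^ 2 * emb y, -emb z]

/-- Action of a letter on Bloch coordinates, up to scaling. -/
def act : Bool → (ℤ√2) × (ℤ√2) × (ℤ√2) → (ℤ√2) × (ℤ√2) × (ℤ√2)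
  | false, (x, y, z) => (⟨0, 1⟩ * z, -(x + y), x - y)
  | true, (x, y, z) => (x + y, ⟨0, 1⟩ * z, x - y)

/-- Bloch vector of a word. -/
def vec : List Bool → (ℤ√2) × (ℤ√2) × (ℤ√2)
  | [] => (1, 0, 0)
  | b :: l => act b (vec l)

lemma emb_add (x y : ℤ√2) : emb (x + y) = emb x + emb y := by
  simp [emb]; ring
lemma emb_neg (x : ℤ√2) : emb (-x) = -emb x := by
  simp [emb]; ring
lemma emb_sub (x y : ℤ√2) : emb (x - y) = emb x - emb y := by
  simp [emb]; ring
lemma emb_sqrt_mul (x : ℤ√2) : emb (⟨0, 1⟩ * x) = (Real.sqrt 2 : ℝ) * emb x := by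
  have h := sqrt2_sq'
  simp [emb]; linear_combination -x.im * h

lemma emb_inj : Function.Injective emb := by
  intro x y h
  have h1 : (x.re : ℝ) + x.im * Real.sqrt 2 = y.re + y.im * Real.sqrt 2 := by
    unfold emb at h
    exact_mod_cast h
  by_cases hi : x.im = y.im
  · rw [hi] at h1
    have : x.re = y.re := by exact_mod_cast add_right_cancel h1
    exact Zsqrtd.ext this hi
  · exfalso
    have hne : ((x.im - y.im : ℤ) : ℝ) ≠ 0 := by
      exact_mod_cast sub_ne_zero.mpr hi
    have h2 : Real.sqrt 2 = (((y.re - x.re : ℤ) : ℚ) / ((x.im - y.im : ℤ) : ℚ) : ℚ) := by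
      push_cast at hne ⊢
      rw [eq_div_iff hne]
      linear_combination h1
    exact irrational_sqrt_two ⟨_, h2.symm⟩

lemma blo_inj {u v : (ℤ√2) × (ℤ√2) × (ℤ√2)}
    (h : blo u.1 u.2.1 u.2.2 = blo v.1 v.2.1 v.2.2) : u = v := by
  have h00 := congrFun (congrFun h 0) 0
  have h01 := congrFun (congrFun h 0) 1
  have h10 := congrFun (congrFun h 1) 0
  simp [blo] at h00 h01 h10
  have hx : emb u.1 = emb v.1 := by linear_combination (h01 + h10) / 2
  have hy : emb u.2.1 = emb v.2.1 := by
    have h4 := omega_four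
    linear_combination -ω ^ 2 * (h10 - h01) / 2 + (emb u.2.1 - emb v.2.1) * h4
  exact Prod.ext (emb_inj hx) (Prod.ext (emb_inj hy) (emb_inj h00))

lemma ltr_blo (b : Bool) (v : (ℤ√2) × (ℤ√2) × (ℤ√2)) :
    ltr b * blo v.1 v.2.1 v.2.2 * (ltr b).conjTranspose =
      ((Real.sqrt 2 : ℝ) : ℂ) • blo (act b v).1 (act b v).2.1 (act b v).2.2 := by
  obtain ⟨x, y, z⟩ := v
  have h4 := omega_four
  cases b <;> ext i j <;> fin_cases i <;> fin_cases j <;>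
    simp [ltr, blo, act, Matrix.mul_apply, Fin.sum_univ_two, conj_omega, emb_add, emb_sub,
      emb_neg, emb_sqrt_mul] <;> simp only [sqrt2_omega] <;> grind

lemma ltr_unit (b : Bool) : ltr b * (ltr b).conjTranspose = (2 : ℂ) • 1 := by
  have h4 := omega_four
  cases b <;> ext i j <;> fin_cases i <;> fin_cases j <;>
    simp [ltr, Matrix.mul_apply, Fin.sum_univ_two, conj_omega] <;> grind

lemma wrd_unit (l : List Bool) :
    wrd l * (wrd l).conjTranspose = ((2 : ℂ) ^ l.length) • 1 := by
  induction l with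
  | nil => simp [wrd]
  | cons b l ih =>
    rw [wrd, Matrix.conjTranspose_mul, Matrix.mul_assoc, ← Matrix.mul_assoc (wrd l), ih]
    simp [ltr_unit, smul_smul, pow_succ]

lemma wrd_blo (l : List Bool) :
    wrd l * blo 1 0 0 * (wrd l).conjTranspose =
      (((Real.sqrt 2 : ℝ) : ℂ) ^ l.length) • blo (vec l).1 (vec l).2.1 (vec l).2.2 := by
  induction l with
  | nil => simp [wrd, vec]
  | cons b l ih =>
    have : wrd (b :: l) * blo 1 0 0 * (wrd (b :: l)).conjTranspose =
        ltr b * (wrd l * blo 1 0 0 * (wrd l).conjTranspose) * (ltr b).conjTranspose := by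
      rw [wrd, Matrix.conjTranspose_mul]
      simp only [Matrix.mul_assoc]
    rw [this, ih, Matrix.mul_smul, Matrix.smul_mul, ltr_blo, smul_smul, List.length_cons,
      pow_succ, vec]

lemma wrd_inZ (l : List Bool) (i j : Fin 2) : inZω (wrd l i j) := by
  induction l generalizing i j with
  | nil =>
    simp only [wrd, Matrix.one_apply]
    split_ifs
    exacts [inZ_one, inZ_zero]
  | cons b l ih =>
    rw [wrd, Matrix.mul_apply, Fin.sum_univ_two]
    have hl : ∀ i j, inZω (ltr b i j) := by
      intro i j
      cases b <;> fin_cases i <;> fin_cases j <;> simp [ltr]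
      · exact inZ_one
      · exact ⟨0, 0, 1, 0, by simp⟩
      · exact inZ_one
      · exact ⟨0, 0, -1, 0, by simp⟩
      · exact inZ_one
      · exact ⟨0, 0, 1, 0, by simp⟩
      · exact ⟨0, 1, 0, 0, by simp⟩
      · exact ⟨-1, 0, 0, 0, by simp⟩
    exact inZ_add (inZ_mul (hl _ _) (ih _ _)) (inZ_mul (hl _ _) (ih _ _))

lemma vec_parity (l : List Bool) : ((vec l).1.re + (vec l).2.1.re) % 2 = 1 := by
  induction l with
  | nil => simp [vec]
  | cons b l ih =>
    revert ih
    rcases vec_eq : vec l with ⟨x, y, z⟩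
    intro ih
    cases b <;> simp [vec, act, vec_eq] at ih ⊢ <;> clear vec_eq <;> generalize x.re = p at * <;> generalize y.re = q at * <;> omega

lemma act_inj (b : Bool) : Function.Injective (act b) := by
  rintro ⟨x, y, z⟩ ⟨x', y', z'⟩ h
  cases b <;> simp [act, Zsqrtd.ext_iff] at h ⊢ <;> omega

lemma vec_inj (l l' : List Bool) (hlen : l.length = l'.length) (h : vec l = vec l') :
    l = l' := by
  induction l generalizing l' with
  | nil => cases l' with
    | nil => rfl
    | cons b l' => simp at hlen
  | cons b l ih => cases l' with
    | nil => simp at hlen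
    | cons b' l' =>
      have hb : b = b' := by
        have p1 := vec_parity l
        have p2 := vec_parity l'
        have h1 := congrArg (fun v => v.1.re) h
        clear ih h hlen
        cases b <;> cases b' <;> simp only [vec, act] at h1 ⊢ <;>
          simp at h1 ⊢ <;>
          generalize (vec l).1.re = p at * <;> generalize (vec l).2.1.re = q at * <;>
          generalize (vec l').1.re = p' at * <;> generalize (vec l').2.1.re = q' at * <;>
          generalize (vec l).2.2.im = r at * <;> generalize (vec l').2.2.im = r' at * <;> omega
      subst hb
      rw [ih l' (by simpa using hlen) (act_inj b h)]

lemma wrd_inj (l l' : List Bool) (hlen : l.length = l'.length) (h : wrd l = wrd l') :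
    l = l' := by
  apply vec_inj l l' hlen
  have h1 := wrd_blo l
  rw [h, wrd_blo l', hlen] at h1
  exact (blo_inj (smul_right_injective _ (pow_ne_zero _ sqrt2_ne') h1)).symm

/-- The unitary of a word. -/
def uni (l : List Bool) : Matrix (Fin 2) (Fin 2) ℂ :=
  ((((Real.sqrt 2 : ℝ) : ℂ) ^ l.length)⁻¹) • wrd l

lemma uni_unit (l : List Bool) : uni l * (uni l).conjTranspose = 1 := by
  have h2 : (2 : ℂ) ^ l.length = (((Real.sqrt 2 : ℝ) : ℂ) ^ l.length) ^ 2 := by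
    rw [← pow_mul, mul_comm, pow_mul, sqrt2_sq']
  have h0 := pow_ne_zero l.length sqrt2_ne'
  rw [uni, Matrix.conjTranspose_smul, Matrix.smul_mul, Matrix.mul_smul, wrd_unit, smul_smul,
    smul_smul, h2]
  have hs : star ((((Real.sqrt 2 : ℝ) : ℂ) ^ l.length)⁻¹) =
      ((((Real.sqrt 2 : ℝ) : ℂ) ^ l.length)⁻¹) := by
    simp [Complex.conj_ofReal]
  rw [hs]
  have : ((((Real.sqrt 2 : ℝ) : ℂ) ^ l.length)⁻¹) * ((((Real.sqrt 2 : ℝ) : ℂ) ^ l.length)⁻¹ *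
      (((Real.sqrt 2 : ℝ) : ℂ) ^ l.length) ^ 2) = 1 := by
    field_simp
  rw [← mul_assoc] at this
  simp only [mul_assoc] at this ⊢
  rw [this, one_smul]

/-- For `n ≥ 1` and `k ∈ ℕ`, there are at least `2^(2^(n−1)·k)` unitary `2^n × 2^n`
matrices with denominator exponent `k`, i.e. such that `√2^k·U` has all entries in `ℤ[ω]`. -/
theorem stmt17 (n : ℕ) (hn : 1 ≤ n) (k : ℕ) :
    (2 ^ (2 ^ (n - 1) * k) : Cardinal) ≤
      Cardinal.mk {U : Matrix (Fin n → Fin 2) (Fin n → Fin 2) ℂ |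
        U ∈ Matrix.unitaryGroup (Fin n → Fin 2) ℂ ∧
        ∀ i j, inZω ((Real.sqrt 2 : ℂ) ^ k * U i j)} := by
  obtain ⟨m, rfl⟩ : ∃ m, n = m + 1 := ⟨n - 1, by omega⟩
  let e : (Fin (m + 1) → Fin 2) ≃ Fin 2 × (Fin m → Fin 2) :=
    (Fin.consEquiv (fun _ : Fin (m + 1) => Fin 2)).symm
  let B : ((Fin m → Fin 2) → List.Vector Bool k) →
      Matrix (Fin (m + 1) → Fin 2) (Fin (m + 1) → Fin 2) ℂ :=
    fun f => (Matrix.blockDiagonal (fun o => uni (f o).toList)).submatrix e e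
  have hB : ∀ f, B f ∈ {U : Matrix (Fin (m + 1) → Fin 2) (Fin (m + 1) → Fin 2) ℂ |
        U ∈ Matrix.unitaryGroup (Fin (m + 1) → Fin 2) ℂ ∧
        ∀ i j, inZω ((Real.sqrt 2 : ℂ) ^ k * U i j)} := by
    intro f
    constructor
    · rw [Matrix.mem_unitaryGroup_iff, Matrix.star_eq_conjTranspose]
      simp only [B]
      rw [Matrix.conjTranspose_submatrix, Matrix.submatrix_mul_equiv,
        Matrix.blockDiagonal_conjTranspose, ← Matrix.blockDiagonal_mul]
      simp only [uni_unit]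
      erw [Matrix.blockDiagonal_one]
      simp
    · intro i j
      simp only [B, Matrix.submatrix_apply, Matrix.blockDiagonal_apply]
      split_ifs
      · have h0 := pow_ne_zero k sqrt2_ne'
        simp only [uni, List.Vector.toList_length, Matrix.smul_apply, smul_eq_mul]
        rw [mul_inv_cancel_left₀ h0]
        exact wrd_inZ _ _ _
      · rw [mul_zero]; exact inZ_zero
  have hinj : Function.Injective (fun f => (⟨B f, hB f⟩ :
      {U : Matrix (Fin (m + 1) → Fin 2) (Fin (m + 1) → Fin 2) ℂ |
        U ∈ Matrix.unitaryGroup (Fin (m + 1) → Fin 2) ℂ ∧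
        ∀ i j, inZω ((Real.sqrt 2 : ℂ) ^ k * U i j)})) := by
    intro f g h
    have h1 : B f = B g := congrArg Subtype.val h
    have h2 : Matrix.blockDiagonal (fun o => uni (f o).toList) =
        Matrix.blockDiagonal (fun o => uni (g o).toList) := by
      have := congrArg (fun M => M.submatrix e.symm e.symm) h1
      simpa [B] using this
    have h3 := Matrix.blockDiagonal_injective h2
    funext o
    have h4 : uni (f o).toList = uni (g o).toList := congrFun h3 o
    simp only [uni, List.Vector.toList_length] at h4
    have h5 := smul_right_injective _ (inv_ne_zero (pow_ne_zero k sqrt2_ne')) h4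
    exact List.Vector.toList_injective (wrd_inj _ _ (by simp) h5)
  refine le_trans (le_of_eq ?_) (Cardinal.mk_le_of_injective hinj)
  rw [Cardinal.mk_fintype]
  simp only [Fintype.card_fun, card_vector, Fintype.card_bool, Fintype.card_fin]
  push_cast
  rw [← pow_mul, mul_comm]
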